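/- Let κ ≥ 2 be an integer, let X ⊆ {1,…,κ}^ℕ be a topologically mixing subshift of finite type, and let σ : X → X be the left shift. Let ℰ_σ ⊆ X be the set of points x ∈ X at which the pointwise emergence of σ is super-polynomial, i.e. limsup_{ε→0⁺} log ℰ_{σ,x}(ε)/(−log ε) = ∞. Then the Hausdorff dimension of ℰ_σ equals the Hausdorff dimension of X: dim_H(ℰ_σ) = dim_H(X). -/

import Mathlib

open MeasureTheory Filter Set

/-- The first Wasserstein distance between two Borel probability measures on a metric
space: the infimum of `∫ d(x,y) dP` over all couplings `P` of the two measures. -/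
noncomputable def wassersteinDist {M : Type*} [MetricSpace M] [MeasurableSpace M]
    (μ ν : Measure M) : ℝ :=
  sInf { r : ℝ | ∃ P : Measure (M × M), IsProbabilityMeasure P ∧
    P.map Prod.fst = μ ∧ P.map Prod.snd = ν ∧ r = ∫ p, dist p.1 p.2 ∂P }

/-- The `n`-th empirical measure `δ_x^n = (1/n) ∑_{k<n} δ_{f^k x}` of the point `x`. -/
noncomputable def empiricalMeasure {M : Type*} [MetricSpace M] [MeasurableSpace M]
    (f : M → M) (x : M) (n : ℕ) : Measure M :=
  (n : ENNReal)⁻¹ • ∑ k ∈ Finset.range n, Measure.dirac (f^[k] x)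

/-- The pointwise emergence `ℰ_{f,x}(ε)`: the least `N ≥ 1` such that there are Borel
probability measures `μ_1, …, μ_N` with
`limsup_{n→∞} min_{1≤j≤N} d_W(δ_x^n, μ_j) ≤ ε`. -/
noncomputable def pointwiseEmergence {M : Type*} [MetricSpace M] [MeasurableSpace M]
    (f : M → M) (x : M) (ε : ℝ) : ℕ :=
  sInf { N : ℕ | 0 < N ∧ ∃ μs : Fin N → Measure M, (∀ j, IsProbabilityMeasure (μs j)) ∧
    Filter.limsup (fun n : ℕ => ⨅ j, wassersteinDist (empiricalMeasure f x n) (μs j))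
      Filter.atTop ≤ ε }

/-- The pointwise emergence of `f` at `x` is super-polynomial:
`limsup_{ε→0⁺} log ℰ_{f,x}(ε) / (−log ε) = ∞`. -/
def superPolynomialEmergence {M : Type*} [MetricSpace M] [MeasurableSpace M]
    (f : M → M) (x : M) : Prop :=
  Filter.limsup
    (fun ε : ℝ => ((Real.log (pointwiseEmergence f x ε) / (-Real.log ε) : ℝ) : EReal))
    (nhdsWithin 0 (Set.Ioi 0)) = ⊤

section Wasserstein

variable {M : Type*} [MetricSpace M] [MeasurableSpace M]

lemma wassersteinDist_nonneg (μ ν : Measure M) : 0 ≤ wassersteinDist μ ν := by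
  refine Real.sInf_nonneg ?_
  rintro r ⟨P, -, -, -, rfl⟩
  exact integral_nonneg fun p => dist_nonneg

lemma wassersteinDist_le_integral (P : Measure (M × M)) [IsProbabilityMeasure P] :
    wassersteinDist (P.map Prod.fst) (P.map Prod.snd) ≤ ∫ p, dist p.1 p.2 ∂P := by
  refine csInf_le ⟨0, ?_⟩ ⟨P, inferInstance, rfl, rfl, rfl⟩
  rintro r ⟨P, -, -, -, rfl⟩
  exact integral_nonneg fun p => dist_nonneg

variable [BorelSpace M] [SecondCountableTopology M]

lemma integrable_of_forall_mem_Icc {N : Type*} [MeasurableSpace N] {P : Measure N}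
    [IsFiniteMeasure P] {g : N → ℝ} (hg : Measurable g) (h0 : ∀ p, 0 ≤ g p) (h1 : ∀ p, g p ≤ 1) :
    Integrable g P :=
  Integrable.of_bound hg.aestronglyMeasurable 1
    (Eventually.of_forall fun p => by rw [Real.norm_of_nonneg (h0 p)]; exact h1 p)

lemma integrable_dist (hd : ∀ x y : M, dist x y ≤ 1) (P : Measure (M × M)) [IsFiniteMeasure P] :
    Integrable (fun p => dist p.1 p.2) P :=
  integrable_of_forall_mem_Icc measurable_dist (fun _ => dist_nonneg) (fun _ => hd _ _)

lemma wassersteinDist_le_one (hd : ∀ x y : M, dist x y ≤ 1) (μ ν : Measure M)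
    [IsProbabilityMeasure μ] [IsProbabilityMeasure ν] : wassersteinDist μ ν ≤ 1 := by
  have h := wassersteinDist_le_integral (μ.prod ν)
  simp only [Measure.map_fst_prod, Measure.map_snd_prod, measure_univ, one_smul] at h
  refine h.trans ?_
  calc ∫ p, dist p.1 p.2 ∂(μ.prod ν) ≤ ∫ _, (1 : ℝ) ∂(μ.prod ν) :=
        integral_mono (integrable_dist hd _) (integrable_const _) fun p => hd _ _
    _ = 1 := by simp

lemma abs_integral_sub_integral_le_wassersteinDist (hd : ∀ x y : M, dist x y ≤ 1)
    (μ ν : Measure M) [IsProbabilityMeasure μ] [IsProbabilityMeasure ν] {φ : M → ℝ}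
    (hφ : LipschitzWith 1 φ) (h0 : ∀ x, 0 ≤ φ x) (h1 : ∀ x, φ x ≤ 1) :
    |∫ x, φ x ∂μ - ∫ x, φ x ∂ν| ≤ wassersteinDist μ ν := by
  refine le_csInf ⟨_, μ.prod ν, inferInstance, by simp, by simp, rfl⟩ ?_
  rintro r ⟨P, hP, rfl, rfl, rfl⟩
  have hm : Measurable φ := hφ.continuous.measurable
  have hi1 : Integrable (fun p : M × M => φ p.1) P :=
    integrable_of_forall_mem_Icc (hm.comp measurable_fst) (fun _ => h0 _) (fun _ => h1 _)
  have hi2 : Integrable (fun p : M × M => φ p.2) P :=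
    integrable_of_forall_mem_Icc (hm.comp measurable_snd) (fun _ => h0 _) (fun _ => h1 _)
  rw [integral_map measurable_fst.aemeasurable hm.aestronglyMeasurable,
    integral_map measurable_snd.aemeasurable hm.aestronglyMeasurable, ← integral_sub hi1 hi2]
  refine abs_integral_le_integral_abs.trans ?_
  refine integral_mono (hi1.sub hi2).abs (integrable_dist hd _) fun p => ?_
  simpa [Real.dist_eq] using hφ.dist_le_mul p.1 p.2

/-- The coupling that sends the fraction `t i` of the `i`-th cell to `rep i` and the rest to
`x₀`. -/
lemma wassersteinDist_quantization_le (hd : ∀ x y : M, dist x y ≤ 1) {ι : Type*} [Fintype ι]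
    {c : M → ι} (hc : ∀ i, MeasurableSet (c ⁻¹' {i})) (rep : ι → M) (x₀ : M) {r : ℝ}
    (hr : ∀ x, dist x (rep (c x)) ≤ r) (μ : Measure M) [IsProbabilityMeasure μ]
    (w : ι → NNReal) (hw : ∀ i, (w i : ENNReal) ≤ μ (c ⁻¹' {i})) {δ : ℝ}
    (hδ : ∀ i, μ.real (c ⁻¹' {i}) - w i ≤ δ) :
    IsProbabilityMeasure
      (∑ i, w i • Measure.dirac (rep i) + (1 - ∑ i, w i) • Measure.dirac x₀) ∧
    wassersteinDist μ
      (∑ i, w i • Measure.dirac (rep i) + (1 - ∑ i, w i) • Measure.dirac x₀) ≤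
      r + Fintype.card ι * δ := by
  classical
  set m : ι → NNReal := fun i => (μ (c ⁻¹' {i})).toNNReal with hm
  have hmc : ∀ i, (m i : ENNReal) = μ (c ⁻¹' {i}) := fun i =>
    ENNReal.coe_toNNReal (measure_ne_top _ _)
  have hmr : ∀ i, (m i : ℝ) = μ.real (c ⁻¹' {i}) := fun i => rfl
  have hwm : ∀ i, w i ≤ m i := fun i => by exact_mod_cast (hmc i ▸ hw i)
  set t : ι → NNReal := fun i => w i / m i
  have ht1 : ∀ i, t i ≤ 1 := fun i => div_le_one_of_le₀ (hwm i) zero_le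
  have htm : ∀ i, t i * m i = w i := fun i => by
    rcases eq_or_ne (m i) 0 with h | h
    · have : w i = 0 := le_antisymm (h ▸ hwm i) zero_le
      simp [h, this]
    · exact div_mul_cancel₀ _ h
  have hsum : μ = ∑ i, μ.restrict (c ⁻¹' {i}) := by
    have h1 : (⋃ i, c ⁻¹' {i}) = univ := by ext x; simp
    have h2 : Pairwise (Function.onFun Disjoint fun i => c ⁻¹' {i}) := fun i j hij =>
      Disjoint.preimage _ (by simpa using hij)
    conv_lhs => rw [← Measure.restrict_univ (μ := μ), ← h1, Measure.restrict_iUnion h2 hc]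
    rw [Measure.sum_fintype]
  have hm1 : ∑ i, m i = 1 := by
    have : ∑ i, (m i : ENNReal) = 1 := by
      simp_rw [hmc]
      have := congrArg (fun ν : Measure M => ν univ) hsum
      simpa using this.symm
    exact_mod_cast this
  set P : Measure (M × M) := ∑ i, (t i • (μ.restrict (c ⁻¹' {i})).map (fun x => (x, rep i)) +
    (1 - t i) • (μ.restrict (c ⁻¹' {i})).map (fun x => (x, x₀))) with hP
  have hpair : ∀ y : M, Measurable fun x : M => (x, y) := fun y => by fun_prop
  have hfst : P.map Prod.fst = μ := by
    rw [hP, Measure.map_finset_sum measurable_fst.aemeasurable]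
    conv_rhs => rw [hsum]
    refine Finset.sum_congr rfl fun i _ => ?_
    rw [Measure.map_add _ _ measurable_fst, Measure.map_smul, Measure.map_smul,
      Measure.map_map measurable_fst (hpair _), Measure.map_map measurable_fst (hpair _)]
    have : ∀ y : M, (Prod.fst ∘ fun x : M => (x, y)) = id := fun y => rfl
    rw [this, this, Measure.map_id, ← add_smul, add_tsub_cancel_of_le (ht1 i), one_smul]
  have hsnd : P.map Prod.snd =
      ∑ i, w i • Measure.dirac (rep i) + (1 - ∑ i, w i) • Measure.dirac x₀ := by
    have hrest : 1 - ∑ i, w i = ∑ i, (1 - t i) * m i := by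
      have h : ∑ i, (1 - t i) * m i + ∑ i, w i = 1 := by
        rw [← Finset.sum_add_distrib]
        refine Eq.trans ?_ hm1
        refine Finset.sum_congr rfl fun i _ => ?_
        rw [← htm i, ← add_mul, tsub_add_cancel_of_le (ht1 i), one_mul]
      exact tsub_eq_of_eq_add h.symm
    rw [hrest, Finset.sum_smul, ← Finset.sum_add_distrib, hP,
      Measure.map_finset_sum measurable_snd.aemeasurable]
    refine Finset.sum_congr rfl fun i _ => ?_
    rw [Measure.map_add _ _ measurable_snd, Measure.map_smul, Measure.map_smul,
      Measure.map_map measurable_snd (hpair _), Measure.map_map measurable_snd (hpair _)]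
    have : ∀ y : M, (Prod.snd ∘ fun x : M => (x, y)) = fun _ => y := fun y => rfl
    rw [this, this, Measure.map_const, Measure.map_const, Measure.restrict_apply_univ, ← hmc,
      ← htm i, mul_smul, mul_smul]
    rfl
  have hPp : IsProbabilityMeasure P := by
    constructor
    rw [← Set.preimage_univ (f := (Prod.fst : M × M → M)),
      ← Measure.map_apply measurable_fst MeasurableSet.univ, hfst, measure_univ]
  have hW := wassersteinDist_le_integral P
  rw [hfst, hsnd] at hW
  refine ⟨hsnd ▸ Measure.isProbabilityMeasure_map measurable_snd.aemeasurable, hW.trans ?_⟩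
  have hint : ∀ i y (s : ℝ), (∀ x ∈ c ⁻¹' {i}, dist x y ≤ s) →
      ∫ p, dist p.1 p.2 ∂(μ.restrict (c ⁻¹' {i})).map (fun x => (x, y)) ≤ s * m i := by
    intro i y s hs
    rw [integral_map (hpair y).aemeasurable measurable_dist.aestronglyMeasurable]
    rw [hmr]
    refine (Real.le_norm_self _).trans ?_
    refine norm_setIntegral_le_of_norm_le_const (measure_lt_top _ _) fun x hx => ?_
    simpa using hs x hx
  rw [hP, integral_finsetSum_measure fun i _ => integrable_dist hd _]
  have hm1' : ∑ i, (m i : ℝ) = 1 := by exact_mod_cast hm1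
  calc _ ≤ ∑ i, (r * m i + δ) := by
        refine Finset.sum_le_sum fun i _ => ?_
        rw [integral_add_measure (integrable_dist hd _) (integrable_dist hd _),
          integral_smul_nnreal_measure, integral_smul_nnreal_measure, NNReal.smul_def,
          NNReal.smul_def, smul_eq_mul, smul_eq_mul, NNReal.coe_sub (ht1 i), NNReal.coe_one]
        have e1 := hint i (rep i) r (fun x hx => by simpa [← show c x = i from hx] using hr x)
        have e2 := hint i x₀ 1 (fun x _ => hd _ _)
        have e3 : (t i : ℝ) * m i = w i := by exact_mod_cast htm i
        have e4 : (t i : ℝ) ≤ 1 := by exact_mod_cast ht1 i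
        have e5 := hδ i
        rw [← hmr] at e5
        have e6 := mul_le_mul_of_nonneg_left e1 (t i).coe_nonneg
        have e7 := mul_le_mul_of_nonneg_left e2 (sub_nonneg.2 e4)
        have e8 : (w i : ℝ) ≤ m i := by exact_mod_cast hwm i
        have hr0 : 0 ≤ r := dist_nonneg.trans (hr x₀)
        nlinarith
    _ = r + Fintype.card ι * δ := by
        rw [Finset.sum_add_distrib, ← Finset.mul_sum, hm1']
        simp

lemma exists_finite_wassersteinDist_net (hd : ∀ x y : M, dist x y ≤ 1) [Nonempty M]
    {ι : Type*} [Fintype ι] {c : M → ι} (hc : ∀ i, MeasurableSet (c ⁻¹' {i})) {r : ℝ}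
    (hr : ∀ x y, c x = c y → dist x y ≤ r) {ε : ℝ} (hε : r < ε) :
    ∃ N, 0 < N ∧ ∃ μs : Fin N → Measure M, (∀ j, IsProbabilityMeasure (μs j)) ∧
      ∀ μ : Measure M, IsProbabilityMeasure μ → ∃ j, wassersteinDist μ (μs j) ≤ ε := by
  classical
  obtain ⟨x₀⟩ := ‹Nonempty M›
  obtain ⟨rep, hrep⟩ : ∃ rep : ι → M, ∀ x, c (rep (c x)) = c x :=
    ⟨fun i => if h : ∃ x, c x = i then h.choose else x₀, fun x => by
      have h : ∃ y, c y = c x := ⟨x, rfl⟩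
      simp only [h, dite_true]
      exact h.choose_spec⟩
  obtain ⟨G, hG⟩ := exists_nat_gt (Fintype.card ι / (ε - r))
  have hG0 : (0 : ℝ) < G := lt_of_le_of_lt (div_nonneg (by positivity) (by linarith)) hG
  let ν : (ι → Fin (G + 1)) → Measure M := fun k =>
    ∑ i, ((k i : ℕ) / G : NNReal) • Measure.dirac (rep i) +
      (1 - ∑ i, ((k i : ℕ) / G : NNReal)) • Measure.dirac x₀
  have key : ∀ μ : Measure M, IsProbabilityMeasure μ →
      ∃ k, IsProbabilityMeasure (ν k) ∧ wassersteinDist μ (ν k) ≤ ε := by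
    intro μ hμ
    have hk : ∀ i, ⌊(G : ℝ) * μ.real (c ⁻¹' {i})⌋₊ < G + 1 := fun i => by
      rw [Nat.lt_succ_iff]
      refine Nat.floor_le_of_le ?_
      exact mul_le_of_le_one_right hG0.le measureReal_le_one
    have hfl : ∀ i, (⌊(G : ℝ) * μ.real (c ⁻¹' {i})⌋₊ : ℝ) / G ≤ μ.real (c ⁻¹' {i}) := fun i => by
      rw [div_le_iff₀ hG0, mul_comm]
      exact Nat.floor_le (by positivity)
    obtain ⟨h1, h2⟩ := wassersteinDist_quantization_le hd hc rep x₀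
      (fun x => hr x _ (hrep x).symm) μ
      (fun i => (⌊(G : ℝ) * μ.real (c ⁻¹' {i})⌋₊ : NNReal) / G) (fun i => by
        rw [← ENNReal.ofReal_coe_nnreal, ← ofReal_measureReal]
        exact ENNReal.ofReal_le_ofReal (by simpa using hfl i)) (δ := 1 / G) (fun i => by
        have := Nat.lt_floor_add_one ((G : ℝ) * μ.real (c ⁻¹' {i}))
        push_cast
        rw [sub_le_iff_le_add, ← add_div, le_div_iff₀ hG0]
        linarith)
    refine ⟨fun i => ⟨_, hk i⟩, h1, h2.trans ?_⟩
    rw [div_lt_iff₀ (by linarith)] at hG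
    have : Fintype.card ι * (1 / (G : ℝ)) ≤ ε - r := by
      rw [mul_one_div, div_le_iff₀ hG0]
      linarith
    linarith
  let T := {k : ι → Fin (G + 1) // IsProbabilityMeasure (ν k)}
  have : Nonempty T := by
    obtain ⟨k, hk, -⟩ := key (Measure.dirac x₀) inferInstance
    exact ⟨⟨k, hk⟩⟩
  refine ⟨Fintype.card T, Fintype.card_pos, fun j => ν ((Fintype.equivFin T).symm j).1,
    fun j => ((Fintype.equivFin T).symm j).2, fun μ hμ => ?_⟩
  obtain ⟨k, hk, hk'⟩ := key μ hμ
  exact ⟨Fintype.equivFin T ⟨k, hk⟩, by simpa using hk'⟩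

end Wasserstein

section Emergence

variable {M : Type*} [MetricSpace M] [MeasurableSpace M]

lemma isProbabilityMeasure_empiricalMeasure (f : M → M) (x : M) {n : ℕ} (hn : n ≠ 0) :
    IsProbabilityMeasure (empiricalMeasure f x n) := by
  constructor
  simp [empiricalMeasure, ENNReal.inv_mul_cancel, hn]

/-- A lower bound `G ^ L ≤ ℰ(c / G) ^ 2` with arbitrarily large `L` forces super-polynomial
emergence. -/
lemma superPolynomialEmergence_of_pow_le {f : M → M} {x : M}
    (h : ∀ L : ℕ, ∃ c : ℝ, 0 < c ∧ ∀ G : ℕ, 0 < G → G ^ L ≤ pointwiseEmergence f x (c / G) ^ 2) :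
    superPolynomialEmergence f x := by
  rw [superPolynomialEmergence, EReal.eq_top_iff_forall_lt]
  intro y
  obtain ⟨L, hL⟩ := exists_nat_gt (4 * max y 0)
  obtain ⟨c, hc, hG⟩ := h L
  have hyL : y < (L : ℝ) / 4 := by
    have := le_max_left y 0
    linarith
  have ht : Tendsto (fun G : ℕ => c / (G : ℝ)) atTop (nhdsWithin 0 (Ioi 0)) := by
    refine tendsto_nhdsWithin_iff.2 ⟨tendsto_const_div_atTop_nhds_zero_nat c, ?_⟩
    filter_upwards [eventually_gt_atTop 0] with G hG
    have : (0 : ℝ) < G := by exact_mod_cast hG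
    exact div_pos hc this
  refine lt_of_lt_of_le (b := (((L : ℝ) / 4 : ℝ) : EReal)) (by exact_mod_cast hyL) ?_
  refine le_limsup_of_frequently_le ?_
  refine ht.frequently (Eventually.frequently ?_)
  have hlog := Real.tendsto_log_atTop.comp (tendsto_natCast_atTop_atTop (R := ℝ))
  filter_upwards [hlog.eventually_gt_atTop (|Real.log c|), eventually_gt_atTop 0] with G h1 h2
  have hGpos : (0 : ℝ) < G := by exact_mod_cast h2
  simp only [Function.comp_apply] at h1
  have hE := hG G h2
  have hlogE : L * Real.log G ≤ 2 * Real.log (pointwiseEmergence f x (c / G)) := by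
    have hpos : (0 : ℝ) < (G : ℝ) ^ L := by positivity
    have := Real.log_le_log hpos (by exact_mod_cast hE :
      (G : ℝ) ^ L ≤ (pointwiseEmergence f x (c / G) : ℝ) ^ 2)
    rwa [Real.log_pow, Real.log_pow, Nat.cast_ofNat] at this
  rw [Real.log_div hc.ne' hGpos.ne']
  have h3 := abs_lt.1 h1
  norm_cast
  rw [le_div_iff₀ (by linarith)]
  have h4 : (L : ℝ) * (-(Real.log c - Real.log G)) ≤ L * (2 * Real.log G) := by
    gcongr
    linarith
  linarith

variable [BorelSpace M] [SecondCountableTopology M]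

lemma integral_empiricalMeasure (f : M → M) (x : M) (n : ℕ) (φ : M → ℝ) :
    ∫ y, φ y ∂(empiricalMeasure f x n) = (n : ℝ)⁻¹ * birkhoffSum f φ n x := by
  rw [empiricalMeasure, integral_smul_measure,
    integral_finsetSum_measure fun i _ => integrable_dirac (by simp)]
  simp [birkhoffSum]

/-- Every space satisfying `hnet` has finite pointwise emergence at every scale. -/
lemma pointwiseEmergence_spec (hd : ∀ x y : M, dist x y ≤ 1)
    (hnet : ∀ r : ℝ, 0 < r → ∃ (k : ℕ) (c : M → Fin k), (∀ i, MeasurableSet (c ⁻¹' {i})) ∧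
      ∀ x y, c x = c y → dist x y ≤ r)
    (f : M → M) (x : M) {ε ε' : ℝ} (hε : 0 < ε) (hε' : ε < ε') :
    ∃ μs : Fin (pointwiseEmergence f x ε) → Measure M, (∀ j, IsProbabilityMeasure (μs j)) ∧
      ∀ᶠ n in atTop, ∃ j, ∀ φ : M → ℝ, LipschitzWith 1 φ → (∀ y, 0 ≤ φ y) → (∀ y, φ y ≤ 1) →
        |birkhoffSum f φ n x - n * ∫ y, φ y ∂(μs j)| ≤ n * ε' := by
  have hbdd : ∀ {N : ℕ} (μs : Fin N → Measure M) (n : ℕ),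
      BddBelow (range fun j => wassersteinDist (empiricalMeasure f x n) (μs j)) := fun μs n =>
    ⟨0, by rintro _ ⟨j, rfl⟩; exact wassersteinDist_nonneg _ _⟩
  have hmem : pointwiseEmergence f x ε ∈ { N : ℕ | 0 < N ∧ ∃ μs : Fin N → Measure M,
      (∀ j, IsProbabilityMeasure (μs j)) ∧
      Filter.limsup (fun n : ℕ => ⨅ j, wassersteinDist (empiricalMeasure f x n) (μs j))
        Filter.atTop ≤ ε } := by
    refine Nat.sInf_mem ?_
    obtain ⟨k, c, hc, hr⟩ := hnet (ε / 2) (by positivity)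
    have : Nonempty M := ⟨x⟩
    obtain ⟨N, hN, μs, hμs, h⟩ := exists_finite_wassersteinDist_net hd hc hr (half_lt_self hε)
    refine ⟨N, hN, μs, hμs, ?_⟩
    refine limsup_le_of_le ?_ ?_
    · refine IsBoundedUnder.isCoboundedUnder_le ⟨0, ?_⟩
      refine eventually_map.2 (Eventually.of_forall fun n => ?_)
      exact Real.iInf_nonneg fun j => wassersteinDist_nonneg _ _
    · filter_upwards [eventually_ne_atTop 0] with n hn
      obtain ⟨j, hj⟩ := h _ (isProbabilityMeasure_empiricalMeasure f x hn)
      exact (ciInf_le (hbdd μs n) j).trans hj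
  obtain ⟨hN, μs, hμs, hlim⟩ := hmem
  refine ⟨μs, hμs, ?_⟩
  have : Nonempty (Fin (pointwiseEmergence f x ε)) := ⟨⟨0, hN⟩⟩
  have hev := eventually_lt_of_limsup_lt (hlim.trans_lt hε') ⟨1, by
    refine eventually_map.2 ?_
    filter_upwards [eventually_ne_atTop 0] with n hn
    have := isProbabilityMeasure_empiricalMeasure f x hn
    exact (ciInf_le (hbdd μs n) ⟨0, hN⟩).trans (wassersteinDist_le_one hd _ _)⟩
  filter_upwards [hev, eventually_ne_atTop 0] with n hn hn0
  obtain ⟨j, hj⟩ := exists_lt_of_ciInf_lt hn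
  refine ⟨j, fun φ hφ h0 h1 => ?_⟩
  have := isProbabilityMeasure_empiricalMeasure f x hn0
  have h := (abs_integral_sub_integral_le_wassersteinDist hd _ (μs j) hφ h0 h1).trans hj.le
  rw [integral_empiricalMeasure] at h
  have hnpos : (0 : ℝ) < n := by positivity
  have e : birkhoffSum f φ n x - n * ∫ y, φ y ∂(μs j) =
      n * ((n : ℝ)⁻¹ * birkhoffSum f φ n x - ∫ y, φ y ∂(μs j)) := by
    field_simp
  rw [e, abs_mul, abs_of_pos hnpos]
  gcongr

/-- If, along infinitely many time windows `[d q, (d + 1) q + c)`, the averages of the test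
functions `φ i` approach `τ v i`, and the vectors `τ v` are separated, then the emergence at scale
`ε` is at least the square root of the number of such vectors. -/
lemma card_le_pointwiseEmergence_sq (hd : ∀ x y : M, dist x y ≤ 1)
    (hnet : ∀ r : ℝ, 0 < r → ∃ (k : ℕ) (c : M → Fin k), (∀ i, MeasurableSet (c ⁻¹' {i})) ∧
      ∀ x y, c x = c y → dist x y ≤ r)
    (f : M → M) (x : M) {ι V : Type*} [Fintype V] {φ : ι → M → ℝ}
    (hφ : ∀ i, LipschitzWith 1 (φ i)) (h0 : ∀ i y, 0 ≤ φ i y) (h1 : ∀ i y, φ i y ≤ 1)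
    (τ : V → ι → ℝ) (d c : ℕ) (C : ℝ)
    (hx : ∀ v, ∃ᶠ q : ℕ in atTop, ∀ i, |birkhoffSum f (φ i) ((d + 1) * q + c) x -
      birkhoffSum f (φ i) (d * q) x - q * τ v i| ≤ C)
    (hd0 : 0 < d) {ε : ℝ} (hε : 0 < ε)
    (hsep : ∀ v v', v ≠ v' → ∃ i, (8 * d + 6) * ε < |τ v i - τ v' i|) :
    Fintype.card V ≤ pointwiseEmergence f x ε ^ 2 := by
  obtain ⟨μs, hμs, hev⟩ :=
    pointwiseEmergence_spec hd hnet f x hε (show ε < 2 * ε by linarith)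
  have hlarge : ∀ᶠ q : ℕ in atTop, C + c + c * (2 * ε) ≤ q * ε := by
    have := (tendsto_natCast_atTop_atTop (R := ℝ)).atTop_mul_const hε
    exact this.eventually_ge_atTop _
  have ht1 : Tendsto (fun q : ℕ => d * q) atTop atTop :=
    tendsto_id.const_mul_atTop' hd0
  have ht2 : Tendsto (fun q : ℕ => (d + 1) * q + c) atTop atTop :=
    tendsto_atTop_mono (fun q => by simp only [id]; nlinarith) tendsto_id
  have hv : ∀ v, ∃ p : Fin (pointwiseEmergence f x ε) × Fin (pointwiseEmergence f x ε),
      ∀ i, |τ v i - ((d + 1) * ∫ y, φ i y ∂(μs p.2) - d * ∫ y, φ i y ∂(μs p.1))| ≤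
        (4 * d + 3) * ε := by
    intro v
    obtain ⟨q, hq, ⟨j₁, hj₁⟩, ⟨j₂, hj₂⟩, hqC, hq0⟩ := ((hx v).and_eventually
      ((ht1.eventually hev).and ((ht2.eventually hev).and
        (hlarge.and (eventually_gt_atTop 0))))).exists
    refine ⟨(j₁, j₂), fun i => ?_⟩
    have a1 := abs_le.1 (hj₁ (φ i) (hφ i) (h0 i) (h1 i))
    have a2 := abs_le.1 (hj₂ (φ i) (hφ i) (h0 i) (h1 i))
    have a3 := abs_le.1 (hq i)
    have hI0 : 0 ≤ ∫ y, φ i y ∂(μs j₂) := integral_nonneg (h0 i)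
    have hI1 : ∫ y, φ i y ∂(μs j₂) ≤ 1 := by
      have := hμs j₂
      calc _ ≤ ∫ _, (1 : ℝ) ∂(μs j₂) :=
            integral_mono (integrable_of_forall_mem_Icc (hφ i).continuous.measurable (h0 i) (h1 i))
              (integrable_const _) (h1 i)
        _ = 1 := by simp
    have hqpos : (0 : ℝ) < q := by exact_mod_cast hq0
    push_cast at a1 a2
    have hc1 : (c : ℝ) * ∫ y, φ i y ∂(μs j₂) ≤ c := mul_le_of_le_one_right (by positivity) hI1
    have hc0 : 0 ≤ (c : ℝ) * ∫ y, φ i y ∂(μs j₂) := by positivity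
    rw [← mul_le_mul_iff_right₀ hqpos, ← abs_of_pos hqpos, ← abs_mul, abs_of_pos hqpos, abs_le]
    constructor <;> nlinarith
  choose p hp using hv
  have hinj : Function.Injective p := by
    intro v v' hvv
    by_contra hne
    obtain ⟨i, hi⟩ := hsep v v' hne
    have b1 := abs_le.1 (hp v i)
    have b2 := abs_le.1 (hp v' i)
    rw [hvv] at b1
    refine hi.not_ge (abs_le.2 ⟨?_, ?_⟩) <;> linarith
  have := Fintype.card_le_of_injective p hinj
  simpa [sq] using this

end Emergence

attribute [local instance] PiNat.metricSpace

/-- The one-sided subshift of finite type with transition matrix `A`. -/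
abbrev Subshift {κ : ℕ} (A : Matrix (Fin κ) (Fin κ) ℕ) :=
  {x : ℕ → Fin κ // ∀ n, A (x n) (x (n + 1)) = 1}

namespace Subshift

variable {κ : ℕ} {A : Matrix (Fin κ) (Fin κ) ℕ}

lemma dist_le_one (x y : Subshift A) : dist x y ≤ 1 := PiNat.dist_le_one x.1 y.1

lemma dist_le_of_forall_lt {x y : Subshift A} {n : ℕ} (h : ∀ i < n, x.1 i = y.1 i) :
    dist x y ≤ (1 / 2) ^ n := by
  have : x.1 ∈ PiNat.cylinder y.1 n := h
  exact PiNat.mem_cylinder_iff_dist_le.1 this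

lemma le_dist_of_ne {x y : Subshift A} {n : ℕ} (h : x.1 n ≠ y.1 n) :
    (1 / 2) ^ n ≤ dist x y := by
  by_contra! hlt
  exact h (PiNat.apply_eq_of_dist_lt (x := x.1) (y := y.1) hlt le_rfl)

lemma exists_fin_partition (r : ℝ) (hr : 0 < r) : ∃ (k : ℕ) (c : Subshift A → Fin k),
    (∀ i, MeasurableSet (c ⁻¹' {i})) ∧ ∀ x y, c x = c y → dist x y ≤ r := by
  obtain ⟨n, hn⟩ := exists_pow_lt_of_lt_one hr (show (1 / 2 : ℝ) < 1 by norm_num)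
  let e := Fintype.equivFin (Fin n → Fin κ)
  have hm : Measurable fun x : Subshift A => fun i : Fin n => x.1 i :=
    measurable_pi_lambda _ fun i => (measurable_pi_apply _).comp measurable_subtype_coe
  refine ⟨_, fun x => e fun i => x.1 i, fun i => ?_, fun x y hxy => ?_⟩
  · exact (measurable_of_finite e).comp hm (measurableSet_singleton i)
  · refine (dist_le_of_forall_lt fun i hi => ?_).trans hn.le
    exact congrFun (e.injective hxy) ⟨i, hi⟩

lemma exists_path (hA : ∀ i j, A i j = 0 ∨ A i j = 1) {n : ℕ} {i j : Fin κ}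
    (h : 0 < (A ^ n) i j) :
    ∃ p : ℕ → Fin κ, p 0 = i ∧ p n = j ∧ ∀ k < n, A (p k) (p (k + 1)) = 1 := by
  induction n generalizing j with
  | zero =>
    refine ⟨fun _ => i, rfl, ?_, by simp⟩
    by_contra hne
    simp [Matrix.one_apply_ne hne] at h
  | succ n ih =>
    rw [pow_succ, Matrix.mul_apply] at h
    obtain ⟨l, -, hl⟩ := Finset.exists_ne_zero_of_sum_ne_zero h.ne'
    obtain ⟨p, hp0, hpn, hp⟩ := ih (Nat.pos_of_ne_zero (left_ne_zero_of_mul hl))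
    refine ⟨fun k => if k ≤ n then p k else j, by simp [hp0], by simp, fun k hk => ?_⟩
    rcases (Nat.lt_succ_iff.1 hk).lt_or_eq with hlt | rfl
    · simpa [hlt.le, Nat.succ_le_of_lt hlt] using hp k hlt
    · simpa [hpn] using (hA l j).resolve_left (right_ne_zero_of_mul hl)

/-- Any prefix can be followed by any point after a connecting word of length `N`. -/
lemma exists_glue (hA : ∀ i j, A i j = 0 ∨ A i j = 1) {N : ℕ} (hN : ∀ i j, 0 < (A ^ (N + 1)) i j)
    (u : Subshift A) (n : ℕ) (v : Subshift A) :
    ∃ g : Subshift A, (∀ i < n, g.1 i = u.1 i) ∧ ∀ j, g.1 (n + N + j) = v.1 j := by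
  obtain ⟨p, hp0, hpN, hp⟩ := exists_path hA (hN (u.1 (n - 1)) (v.1 0))
  let g : ℕ → Fin κ := fun i =>
    if i < n then u.1 i else if i < n + N then p (i - n + 1) else v.1 (i - (n + N))
  refine ⟨⟨g, fun i => ?_⟩, fun i hi => by simp [g, hi], fun j => ?_⟩
  · by_cases h1 : i + 1 < n
    · simpa [g, h1, (Nat.lt_succ_self i).trans h1] using u.2 i
    by_cases h2 : i < n
    · obtain rfl : n = i + 1 := by omega
      have hz := hp 0 (by omega)
      rw [hp0] at hz
      rcases Nat.eq_zero_or_pos N with rfl | hNpos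
      · simpa [g, hpN] using hz
      · simpa [g, hNpos] using hz
    by_cases h3 : i + 1 < n + N
    · have := hp (i - n + 1) (by omega)
      have e : i + 1 - n = i - n + 1 := by omega
      simpa [g, h1, h2, h3, (Nat.lt_succ_self i).trans h3, e] using this
    by_cases h4 : i < n + N
    · have := hp (i - n + 1) (by omega)
      have e : i - n + 1 + 1 = N + 1 := by omega
      have e' : i + 1 - (n + N) = 0 := by omega
      rw [e, hpN] at this
      simpa [g, h1, h2, h3, h4, e'] using this
    · have e : i + 1 - (n + N) = i - (n + N) + 1 := by omega
      simpa [g, h1, h2, h3, h4, e] using v.2 (i - (n + N))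
  · have h1 : ¬ n + N + j < n := by omega
    simp [g, h1]

section Shift

variable {σ : Subshift A → Subshift A}

lemma iterate_shift_apply
    (hσ : ∀ x, (σ x).1 = fun n => x.1 (n + 1))
    (x : Subshift A) (k n : ℕ) : (σ^[k] x).1 n = x.1 (k + n) := by
  induction k generalizing x with
  | zero => simp
  | succ k ih =>
    rw [Function.iterate_succ_apply, ih, hσ]
    exact congrArg x.1 (by omega)

lemma abs_birkhoffSum_sub_le
    (hσ : ∀ x, (σ x).1 = fun n => x.1 (n + 1))
    {φ : Subshift A → ℝ} (hφ : LipschitzWith 1 φ) {n : ℕ}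
    {x y : Subshift A} (h : ∀ i < n, x.1 i = y.1 i) :
    |birkhoffSum σ φ n x - birkhoffSum σ φ n y| ≤ 1 := by
  suffices |birkhoffSum σ φ n x - birkhoffSum σ φ n y| ≤ 1 - (1 / 2) ^ n from
    this.trans (sub_le_self _ (by positivity))
  induction n generalizing x y with
  | zero => simp
  | succ n ih =>
    have h1 := ih (x := σ x) (y := σ y) fun i hi => by
      rw [hσ, hσ]
      exact h (i + 1) (by omega)
    have h2 : |φ x - φ y| ≤ (1 / 2) ^ (n + 1) := by
      have := hφ.dist_le_mul x y
      rw [Real.dist_eq, NNReal.coe_one, one_mul] at this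
      exact this.trans (dist_le_of_forall_lt h)
    rw [birkhoffSum_succ', birkhoffSum_succ']
    have h3 : (1 / 2 : ℝ) ^ (n + 1) = (1 / 2) ^ n / 2 := by ring
    rw [h3] at h2 ⊢
    rw [abs_le] at h1 h2 ⊢
    constructor <;> linarith

end Shift

lemma birkhoffSum_nonneg {α : Type*} {f : α → α} {φ : α → ℝ} (h0 : ∀ y, 0 ≤ φ y) (n : ℕ) (x : α) :
    0 ≤ birkhoffSum f φ n x :=
  Finset.sum_nonneg fun _ _ => h0 _

lemma birkhoffSum_le {α : Type*} {f : α → α} {φ : α → ℝ} (h1 : ∀ y, φ y ≤ 1) (n : ℕ) (x : α) :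
    birkhoffSum f φ n x ≤ n := by
  calc birkhoffSum f φ n x ≤ ∑ k ∈ Finset.range n, (1 : ℝ) := Finset.sum_le_sum fun _ _ => h1 _
    _ = n := by simp

lemma exists_minimalPeriod_eq_prime (hκ : 2 ≤ κ) (hA : ∀ i j, A i j = 0 ∨ A i j = 1) {N : ℕ}
    (hN1 : 1 ≤ N) (hN : ∀ n, N ≤ n → ∀ i j, 0 < (A ^ n) i j)
    {σ : Subshift A → Subshift A} (hσ : ∀ x, (σ x).1 = fun n => x.1 (n + 1))
    {p : ℕ} (hp : p.Prime) (hpN : 2 * N ≤ p) :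
    ∃ z : Subshift A, Function.minimalPeriod σ z = p := by
  obtain ⟨a, b, hab⟩ : ∃ a b : Fin κ, a ≠ b := ⟨⟨0, by omega⟩, ⟨1, by omega⟩, by simp⟩
  obtain ⟨P, hP0, hPN, hP⟩ := exists_path hA (hN N le_rfl a b)
  obtain ⟨Q, hQ0, hQN, hQ⟩ := exists_path hA (hN (p - N) (by omega) b a)
  let l : ℕ → Fin κ := fun k => if k < N then P k else Q (k - N)
  have hl0 : l 0 = a := by simp [l, show 0 < N from hN1, hP0]
  have hlN : l N = b := by simp [l, hQ0]
  have hl : ∀ k < p, A (l k) (l ((k + 1) % p)) = 1 := by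
    intro k hk
    by_cases h1 : k + 1 < N
    · rw [Nat.mod_eq_of_lt (by omega)]
      simpa [l, h1, (Nat.lt_succ_self k).trans h1] using hP k (by omega)
    by_cases h2 : k < N
    · obtain rfl : N = k + 1 := by omega
      rw [Nat.mod_eq_of_lt (by omega), hlN, ← hPN]
      simpa [l] using hP k (by omega)
    have h3 := hQ (k - N) (by omega)
    by_cases h4 : k + 1 = p
    · rw [h4, Nat.mod_self, hl0, ← hQN]
      have e : k - N + 1 = p - N := by omega
      simpa [l, h2, e] using h3
    · rw [Nat.mod_eq_of_lt (by omega)]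
      have e : k + 1 - N = k - N + 1 := by omega
      simpa [l, h1, h2, e] using h3
  let z : Subshift A := ⟨fun n => l (n % p), fun n => by
    have := hl (n % p) (Nat.mod_lt _ hp.pos)
    rwa [Nat.mod_add_mod] at this⟩
  have : Fact p.Prime := ⟨hp⟩
  refine ⟨z, Function.minimalPeriod_eq_prime ?_ fun hfix => hab ?_⟩
  · refine Subtype.ext (funext fun n => ?_)
    rw [iterate_shift_apply hσ]
    simp [z]
  · have h := iterate_shift_apply hσ z N 0
    rw [Function.iterate_fixed hfix] at h
    simpa [z, hl0, Nat.mod_eq_of_lt (show N < p by omega), hlN] using h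

lemma exists_seq_disjoint_finite_orbits (hκ : 2 ≤ κ) (hA : ∀ i j, A i j = 0 ∨ A i j = 1) {N : ℕ}
    (hN1 : 1 ≤ N) (hN : ∀ n, N ≤ n → ∀ i j, 0 < (A ^ n) i j)
    {σ : Subshift A → Subshift A} (hσ : ∀ x, (σ x).1 = fun n => x.1 (n + 1)) :
    ∃ z : ℕ → Subshift A, (∀ i, (range fun k => σ^[k] (z i)).Finite) ∧
      ∀ i j k l, i ≠ j → σ^[k] (z i) ≠ σ^[l] (z j) := by
  have hinf : {p : ℕ | p.Prime ∧ 2 * N ≤ p}.Infinite := by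
    refine Set.infinite_of_not_bddAbove ?_
    rintro ⟨B, hB⟩
    obtain ⟨p, hp, hpp⟩ := Nat.exists_infinite_primes (2 * N + B + 1)
    have := hB (show p ∈ _ from ⟨hpp, by omega⟩)
    omega
  let e := hinf.natEmbedding
  choose z hz using fun i =>
    exists_minimalPeriod_eq_prime hκ hA hN1 hN hσ (e i).2.1 (e i).2.2
  have hper : ∀ i, z i ∈ Function.periodicPts σ := fun i =>
    Function.minimalPeriod_pos_iff_mem_periodicPts.1 (by rw [hz]; exact (e i).2.1.pos)
  refine ⟨z, fun i => ?_, fun i j k l hij heq => ?_⟩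
  · refine ((Set.finite_lt_nat (e i : ℕ)).image fun k => σ^[k] (z i)).subset ?_
    rintro _ ⟨k, rfl⟩
    refine ⟨k % (e i : ℕ), Nat.mod_lt _ (e i).2.1.pos, ?_⟩
    have := Function.iterate_mod_minimalPeriod_eq (f := σ) (x := z i) (n := k)
    rwa [hz] at this
  · have h := congrArg (Function.minimalPeriod σ) heq
    rw [Function.minimalPeriod_apply_iterate (hper i), Function.minimalPeriod_apply_iterate (hper j),
      hz, hz] at h
    exact hij (e.injective (Subtype.ext h))

end Subshift

/-- Finitely many disjoint finite orbits are told apart by `1`-Lipschitz test functions. -/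
lemma exists_lipschitz_separating_orbits {M : Type*} [MetricSpace M]
    (hd : ∀ x y : M, dist x y ≤ 1) {f : M → M} {z : ℕ → M}
    (hfin : ∀ i, (range fun k => f^[k] (z i)).Finite)
    (hz : ∀ i j k l, i ≠ j → f^[k] (z i) ≠ f^[l] (z j)) (L : ℕ) :
    ∃ η : ℝ, 0 < η ∧ ∃ φ : ℕ → M → ℝ, (∀ i, LipschitzWith 1 (φ i)) ∧ (∀ i y, 0 ≤ φ i y) ∧
      (∀ i y, φ i y ≤ 1) ∧
      ∀ i ≤ L, ∀ j ≤ L, ∀ k, φ i (f^[k] (z j)) = if i = j then η else 0 := by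
  let O : ℕ → Set M := fun i => range fun k => f^[k] (z i)
  let T : Set M := ⋃ i ∈ Iic (L + 1), O i
  have hOT : ∀ i ≤ L + 1, O i ⊆ T := fun i hi => subset_biUnion_of_mem (u := O) (mem_Iic.2 hi)
  have hz0 : ∀ i, z i ∈ O i := fun i => ⟨0, rfl⟩
  have hTfin : T.Finite := (finite_Iic _).biUnion fun i _ => hfin i
  have h01 : z 0 ≠ z 1 := hz 0 1 0 0 (by simp)
  have hz0T : z 0 ∈ T := hOT 0 (by omega) (hz0 0)
  have hz1T : z 1 ∈ T := hOT 1 (by omega) (hz0 1)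
  have hη : 0 < T.infsep :=
    hTfin.infsep_pos_iff_nontrivial.2 ⟨z 0, hz0T, z 1, hz1T, h01⟩
  have hη1 : T.infsep ≤ 1 := (infsep_le_dist_of_mem hz0T hz1T h01).trans (hd _ _)
  refine ⟨T.infsep, hη, fun i x => max (T.infsep - Metric.infDist x (O i)) 0, fun i => ?_,
    fun i y => le_max_right _ _, fun i y => ?_, fun i hi j hj k => ?_⟩
  · refine LipschitzWith.max_const ?_ 0
    refine LipschitzWith.of_dist_le_mul fun x y => ?_
    have := (Metric.lipschitz_infDist_pt (O i)).dist_le_mul x y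
    rw [Real.dist_eq] at this ⊢
    rwa [show T.infsep - Metric.infDist x (O i) - (T.infsep - Metric.infDist y (O i)) =
      -(Metric.infDist x (O i) - Metric.infDist y (O i)) by ring, abs_neg]
  · exact max_le (by linarith [Metric.infDist_nonneg (x := y) (s := O i)]) zero_le_one
  · split_ifs with hij
    · subst hij
      have : Metric.infDist (f^[k] (z i)) (O i) = 0 := Metric.infDist_zero_of_mem ⟨k, rfl⟩
      simp [this, hη.le]
    · have : T.infsep ≤ Metric.infDist (f^[k] (z j)) (O i) := by
        refine (Metric.le_infDist ⟨z i, hz0 i⟩).2 ?_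
        rintro _ ⟨l, rfl⟩
        exact infsep_le_dist_of_mem (hOT j (by omega) ⟨k, rfl⟩) (hOT i (by omega) ⟨l, rfl⟩)
          (hz j i k l (Ne.symm hij))
      simp [this]

namespace Subshift

variable {κ : ℕ} {A : Matrix (Fin κ) (Fin κ) ℕ}

/-- Concatenation, with respect to a glueing operation `g`, of prefixes of `z L, …, z 1` of lengths
`r (L - 1), …, r 0`, followed by `z 0`. -/
def block (g : Subshift A → ℕ → Subshift A → Subshift A) (z : ℕ → Subshift A) (r : ℕ → ℕ) :
    ℕ → Subshift A
  | 0 => z 0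
  | L + 1 => g (z (L + 1)) (r L) (block g z r L)

/-- Successive insertion into `x` of the prefixes of length `q k` of `w k` at positions `a k`. -/
def insertBlocks (g : Subshift A → ℕ → Subshift A → Subshift A) (σ : Subshift A → Subshift A)
    (a q : ℕ → ℕ) (w : ℕ → Subshift A) (x : Subshift A) : ℕ → Subshift A
  | 0 => x
  | k + 1 => g (insertBlocks g σ a q w x k) (a k)
      (g (w k) (q k) (σ^[a k] (insertBlocks g σ a q w x k)))

/-- The position of the `p`-th letter of `x` after `k` insertions of words of length `c i` at
positions `a i`. -/
def insertPosition (a c : ℕ → ℕ) (p : ℕ) : ℕ → ℕ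
  | 0 => p
  | k + 1 => if insertPosition a c p k < a k then insertPosition a c p k
      else insertPosition a c p k + c k

lemma insertPosition_le_add_sum (a c : ℕ → ℕ) (p k : ℕ) :
    insertPosition a c p k ≤ p + ∑ j ∈ Finset.range k, c j := by
  induction k with
  | zero => simp [insertPosition]
  | succ k ih =>
    rw [insertPosition, Finset.sum_range_succ]
    split_ifs <;> omega

lemma mul_insertPosition_le {a c : ℕ → ℕ} {D : ℕ} (hD : 2 ≤ D)
    (h : ∀ k, D * ∑ j ∈ Finset.range (k + 1), c j ≤ a k) (p k : ℕ) :
    D * insertPosition a c p k ≤ (D + 2) * p := by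
  induction k with
  | zero => simp only [insertPosition]; nlinarith
  | succ k ih =>
    have h1 := insertPosition_le_add_sum a c p k
    have h2 := insertPosition_le_add_sum a c p (k + 1)
    have h3 := h k
    rw [insertPosition] at h2 ⊢
    rw [Finset.sum_range_succ] at h2 h3
    split_ifs at h2 ⊢ with hlt
    · exact ih
    · have h4 : a k ≤ 2 * p := by nlinarith
      nlinarith

section Glue

variable {g : Subshift A → ℕ → Subshift A → Subshift A} {N : ℕ}
  {σ : Subshift A → Subshift A}

lemma abs_birkhoffSum_block_sub_le
    (hg : ∀ u n v, (∀ i < n, (g u n v).1 i = u.1 i) ∧ ∀ j, (g u n v).1 (n + N + j) = v.1 j)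
    (hσ : ∀ x, (σ x).1 = fun n => x.1 (n + 1))
    {z : ℕ → Subshift A} (r : ℕ → ℕ) {φ : Subshift A → ℝ}
    (hφ : LipschitzWith 1 φ) (h0 : ∀ y, 0 ≤ φ y) (h1 : ∀ y, φ y ≤ 1) (c : ℕ → ℝ)
    (hz0 : ∀ k, φ (σ^[k] (z 0)) = 0) (L : ℕ) (hz : ∀ i < L, ∀ k, φ (σ^[k] (z (i + 1))) = c i)
    (b : ℕ) (hb : ∑ i ∈ Finset.range L, (r i + N) ≤ b) :
    |birkhoffSum σ φ b (block g z r L) - ∑ i ∈ Finset.range L, r i * c i| ≤ L * (N + 1) := by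
  induction L generalizing b with
  | zero => simp [block, birkhoffSum, hz0]
  | succ L ih =>
    rw [Finset.sum_range_succ] at hb ⊢
    obtain ⟨b', rfl⟩ : ∃ b', b = r L + (N + b') := ⟨b - (r L + N), by omega⟩
    have ih' := ih (fun i hi => hz i (by omega)) b' (by omega)
    rw [block]
    set u := block g z r L
    set y := g (z (L + 1)) (r L) u
    have hy := hg (z (L + 1)) (r L) u
    rw [birkhoffSum_add, birkhoffSum_add, ← Function.iterate_add_apply]
    have hu : σ^[N + r L] y = u := Subtype.ext (funext fun n => by
      rw [iterate_shift_apply hσ, add_comm N]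
      exact hy.2 n)
    rw [hu]
    have e1 := abs_birkhoffSum_sub_le hσ hφ hy.1
    have e2 : birkhoffSum σ φ (r L) (z (L + 1)) = r L * c L := by
      simp [birkhoffSum, hz L (Nat.lt_succ_self L)]
    rw [e2] at e1
    have e3 := birkhoffSum_nonneg (f := σ) h0 N (σ^[r L] y)
    have e4 := birkhoffSum_le (f := σ) h1 N (σ^[r L] y)
    push_cast
    rw [abs_le] at e1 ih' ⊢
    constructor <;> nlinarith

lemma insertBlocks_insertPosition
    (hg : ∀ u n v, (∀ i < n, (g u n v).1 i = u.1 i) ∧ ∀ j, (g u n v).1 (n + N + j) = v.1 j)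
    (hσ : ∀ x, (σ x).1 = fun n => x.1 (n + 1))
    (a q : ℕ → ℕ) (w : ℕ → Subshift A) (x : Subshift A) (p k : ℕ) :
    (insertBlocks g σ a q w x k).1 (insertPosition a (fun k => q k + 2 * N) p k) = x.1 p := by
  induction k with
  | zero => rfl
  | succ k ih =>
    rw [insertBlocks, insertPosition]
    split_ifs with h
    · rw [(hg _ _ _).1 _ h, ih]
    · set m := insertPosition a (fun k => q k + 2 * N) p k
      have e : m + (q k + 2 * N) = a k + N + (q k + N + (m - a k)) := by omega
      rw [e, (hg _ _ _).2, (hg _ _ _).2, iterate_shift_apply hσ, ← ih,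
        Nat.add_sub_cancel' (not_lt.1 h)]

/-- The limit of infinitely many insertions. -/
lemma exists_insertBlocks_limit
    (hg : ∀ u n v, (∀ i < n, (g u n v).1 i = u.1 i) ∧ ∀ j, (g u n v).1 (n + N + j) = v.1 j)
    (hσ : ∀ x, (σ x).1 = fun n => x.1 (n + 1))
    {a q : ℕ → ℕ} (w : ℕ → Subshift A) (ha : StrictMono a)
    (haq : ∀ k, a k + N + q k ≤ a (k + 1)) {D : ℕ} (hD : 2 ≤ D)
    (h : ∀ k, D * ∑ j ∈ Finset.range (k + 1), (q j + 2 * N) ≤ a k) :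
    ∃ (Y : Subshift A → Subshift A) (pos : ℕ → ℕ), (∀ p, D * pos p ≤ (D + 2) * p) ∧
      (∀ x p, (Y x).1 (pos p) = x.1 p) ∧
      ∀ x k, ∀ j < q k, (Y x).1 (a k + N + j) = (w k).1 j := by
  have hstable : ∀ x k m, ∀ n < a k,
      (insertBlocks g σ a q w x (k + m)).1 n = (insertBlocks g σ a q w x k).1 n := by
    intro x k m n hn
    induction m with
    | zero => rfl
    | succ m ih =>
      rw [← add_assoc, insertBlocks, (hg _ _ _).1 n (hn.trans_le (ha.monotone (by omega))), ih]
  have hak : ∀ n, n < a (n + 1) := fun n => lt_of_lt_of_le (Nat.lt_succ_self n) (ha.le_apply)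
  have heq : ∀ x k, ∀ n < a k,
      (insertBlocks g σ a q w x (n + 1)).1 n = (insertBlocks g σ a q w x k).1 n := by
    intro x k n hn
    rcases le_total k (n + 1) with hk | hk
    · obtain ⟨m, hm⟩ := Nat.exists_eq_add_of_le hk
      rw [hm, hstable x k m n hn]
    · obtain ⟨m, rfl⟩ := Nat.exists_eq_add_of_le hk
      rw [hstable x (n + 1) m n (hak n)]
  refine ⟨fun x => ⟨fun n => (insertBlocks g σ a q w x (n + 1)).1 n, fun n => ?_⟩,
    fun p => insertPosition a (fun k => q k + 2 * N) p (2 * p + 1),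
    fun p => mul_insertPosition_le hD h _ _, fun x p => ?_, fun x k j hj => ?_⟩
  · beta_reduce
    rw [heq x (n + 2) n (lt_trans (Nat.lt_succ_self n) (hak (n + 1)))]
    exact (insertBlocks g σ a q w x (n + 2)).2 n
  · have h1 := mul_insertPosition_le (c := fun k => q k + 2 * N) hD h p (2 * p + 1)
    have h2 : insertPosition a (fun k => q k + 2 * N) p (2 * p + 1) ≤ 2 * p := by
      nlinarith
    change (insertBlocks g σ a q w x _).1 _ = _
    rw [heq x (2 * p + 1) _ (h2.trans_lt (hak _))]
    exact insertBlocks_insertPosition hg hσ a q w x p (2 * p + 1)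
  · change (insertBlocks g σ a q w x _).1 _ = _
    rw [heq x (k + 1) _ (by have := haq k; omega), insertBlocks, (hg _ _ _).2, (hg _ _ _).1 j hj]

end Glue

lemma dimH_univ_le_of_apply_pos {Y : Subshift A → Subshift A} {pos : ℕ → ℕ} {D : ℕ} (hD : 0 < D)
    (hpos : ∀ p, D * pos p ≤ (D + 2) * p) (hY : ∀ x p, (Y x).1 (pos p) = x.1 p) :
    dimH (univ : Set (Subshift A)) ≤
      dimH (range Y) / (((D : NNReal) / (D + 2) : NNReal) : ENNReal) := by
  rcases isEmpty_or_nonempty (Subshift A) with hE | hE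
  · simp [univ_eq_empty_iff.2 hE]
  have hinj : Function.Injective Y := fun x y hxy => Subtype.ext (funext fun p => by
    rw [← hY x p, ← hY y p, hxy])
  have hr : 0 < ((D : NNReal) / (D + 2) : NNReal) := by positivity
  have hdist : ∀ x y, dist x y ≤ dist (Y x) (Y y) ^ (((D : NNReal) / (D + 2) : NNReal) : ℝ) := by
    intro x y
    rcases eq_or_ne x y with rfl | hne
    · simp only [dist_self]; positivity
    have hne' : x.1 ≠ y.1 := fun h => hne (Subtype.ext h)
    set p := PiNat.firstDiff x.1 y.1
    have h1 : dist x y = (1 / 2 : ℝ) ^ p := PiNat.dist_eq_of_ne hne'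
    have h2 : (1 / 2 : ℝ) ^ pos p ≤ dist (Y x) (Y y) := le_dist_of_ne (by
      rw [hY, hY]
      exact PiNat.apply_firstDiff_ne hne')
    rw [h1]
    refine le_trans ?_ (Real.rpow_le_rpow (by positivity) h2 (NNReal.coe_nonneg _))
    rw [← Real.rpow_natCast, ← Real.rpow_natCast, ← Real.rpow_mul (by norm_num)]
    refine Real.rpow_le_rpow_of_exponent_ge (by norm_num) (by norm_num) ?_
    push_cast
    rw [mul_div_assoc', div_le_iff₀ (by positivity)]
    have : (D : ℝ) * pos p ≤ (D + 2) * p := by exact_mod_cast hpos p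
    linarith
  have hH : HolderOnWith 1 ((D : NNReal) / (D + 2)) (Function.invFun Y) (range Y) := by
    rintro _ ⟨x, rfl⟩ _ ⟨y, rfl⟩
    rw [Function.leftInverse_invFun hinj x, Function.leftInverse_invFun hinj y, ENNReal.coe_one,
      one_mul, edist_dist, edist_dist, ENNReal.ofReal_rpow_of_nonneg dist_nonneg (NNReal.coe_nonneg _)]
    exact ENNReal.ofReal_le_ofReal (hdist x y)
  have := hH.dimH_image_le hr
  rwa [← range_comp, (Function.leftInverse_invFun hinj).comp_eq_id, range_id] at this

lemma exists_seq_frequently_eq (α : Type*) [Countable α] [Nonempty α] :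
    ∃ e : ℕ → α, ∀ t K, ∃ k, K ≤ k ∧ e k = t := by
  obtain ⟨f, hf⟩ := exists_surjective_nat α
  refine ⟨fun k => f k.unpair.1, fun t K => ?_⟩
  obtain ⟨n, rfl⟩ := hf t
  exact ⟨Nat.pair n K, Nat.right_le_pair n K, by simp⟩

/-- A point whose itinerary contains, in the windows `[d q, d q + N + q)`, blocks realizing all
rational frequency vectors along the orbits of the points `z i` has super-polynomial
emergence. -/
lemma superPolynomialEmergence_of_blocks {g : Subshift A → ℕ → Subshift A → Subshift A} {N : ℕ}
    (hg : ∀ u n v, (∀ i < n, (g u n v).1 i = u.1 i) ∧ ∀ j, (g u n v).1 (n + N + j) = v.1 j)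
    {σ : Subshift A → Subshift A} (hσ : ∀ x, (σ x).1 = fun n => x.1 (n + 1))
    {z : ℕ → Subshift A} (hfin : ∀ i, (range fun k => σ^[k] (z i)).Finite)
    (hz : ∀ i j k l, i ≠ j → σ^[k] (z i) ≠ σ^[l] (z j))
    {e : ℕ → List ℕ × ℕ} (he : ∀ t K, ∃ k, K ≤ k ∧ e k = t)
    {q : ℕ → ℕ} (hq : ∀ k, k ≤ q k) {d : ℕ} (hd : 0 < d) {y : Subshift A}
    (hy : ∀ k, ∀ j < q k, y.1 (d * q k + N + j) =
      (block g z (fun i => (e k).1.getD i 0 * q k / (e k).2) (e k).1.length).1 j) :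
    superPolynomialEmergence σ y := by
  refine superPolynomialEmergence_of_pow_le fun L => ?_
  obtain ⟨η, hη, φ, hφ, h0, h1, hφz⟩ :=
    exists_lipschitz_separating_orbits dist_le_one hfin hz L
  refine ⟨η / (2 * (L + 1) * (8 * d + 7)), by positivity, fun G hG => ?_⟩
  have hGpos : (0 : ℝ) < G := by exact_mod_cast hG
  have hcard : Fintype.card (Fin L → Fin G) = G ^ L := by simp
  rw [← hcard]
  refine card_le_pointwiseEmergence_sq dist_le_one exists_fin_partition σ y
    (φ := fun i : Fin L => φ (i + 1)) (fun i => hφ _) (fun i => h0 _) (fun i => h1 _)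
    (fun v i => η * ((v i : ℕ) / (2 * (L + 1) * G : ℕ))) d (2 * N)
    (2 * N + 1 + L * (N + 1) + η) (fun v => ?_) hd (by positivity) fun v v' hvv => ?_
  · rw [frequently_atTop]
    intro K
    obtain ⟨k, hkK, hk⟩ := he (List.ofFn fun i => (v i : ℕ), 2 * (L + 1) * G) (K + 2 * L * N)
    have hqk := hq k
    refine ⟨q k, by omega, fun i => ?_⟩
    set b := q k
    set r : ℕ → ℕ := fun i =>
      (List.ofFn fun i => (v i : ℕ)).getD i 0 * b / (2 * (L + 1) * G) with hr
    have hw : ∀ j < b, y.1 (d * b + N + j) = (block g z r L).1 j := by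
      have := hy k
      simp only [hk, List.length_ofFn] at this
      exact this
    have hri : ∀ i : Fin L, r i = v i * b / (2 * (L + 1) * G) := fun i => by
      simp [hr, List.getD]
    have hrle : ∀ i < L, 2 * (L + 1) * r i ≤ b := fun i hi => by
      have h2 := hri ⟨i, hi⟩
      simp only at h2
      have h3 : r i * (2 * (L + 1) * G) ≤ v ⟨i, hi⟩ * b := by
        rw [h2]; exact Nat.div_mul_le_self _ _
      have h4 : (v ⟨i, hi⟩ : ℕ) * b ≤ G * b := Nat.mul_le_mul_right _ (v ⟨i, hi⟩).2.le
      refine Nat.le_of_mul_le_mul_right (c := G) ?_ hG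
      linarith
    have hsum : ∑ i ∈ Finset.range L, (r i + N) ≤ b := by
      have h2 : 2 * (L + 1) * ∑ i ∈ Finset.range L, r i ≤ L * b := by
        rw [Finset.mul_sum]
        calc _ ≤ ∑ i ∈ Finset.range L, b :=
              Finset.sum_le_sum fun i hi => hrle i (Finset.mem_range.1 hi)
          _ = L * b := by simp
      rw [Finset.sum_add_distrib, Finset.sum_const, Finset.card_range, smul_eq_mul]
      have h3 : 2 * ∑ i ∈ Finset.range L, r i ≤ b := by
        refine le_of_mul_le_mul_left (a := L + 1) ?_ (Nat.succ_pos L)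
        nlinarith
      nlinarith
    have hblock := abs_birkhoffSum_block_sub_le hg hσ (z := z) r (hφ (i + 1)) (h0 _) (h1 _)
      (fun j => if (i : ℕ) = j then η else 0)
      (fun k => by rw [hφz _ (by omega) 0 (by omega)]; simp) L
      (fun j hj k => by rw [hφz _ (by omega) _ (by omega)]; simp) b hsum
    have hone : ∑ j ∈ Finset.range L, (r j : ℝ) * (if (i : ℕ) = j then η else 0) = r i * η := by
      simp [i.2]
    rw [hone] at hblock
    have hmid := abs_birkhoffSum_sub_le hσ (hφ (i + 1)) (n := b)
      (x := σ^[d * b + N] y) (y := block g z r L)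
      (fun j hj => by rw [iterate_shift_apply hσ, hw j hj])
    have hsplit : (d + 1) * b + 2 * N = d * b + N + b + N := by ring
    rw [hsplit, birkhoffSum_add _ _ (d * b + N + b), birkhoffSum_add _ _ (d * b + N),
      birkhoffSum_add _ _ (d * b)]
    have b1 := birkhoffSum_nonneg (f := σ) (h0 (i + 1)) N (σ^[d * b] y)
    have b2 := birkhoffSum_le (f := σ) (h1 (i + 1)) N (σ^[d * b] y)
    have b3 := birkhoffSum_nonneg (f := σ) (h0 (i + 1)) N (σ^[d * b + N + b] y)
    have b4 := birkhoffSum_le (f := σ) (h1 (i + 1)) N (σ^[d * b + N + b] y)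
    have hm : (0 : ℝ) < (2 * (L + 1) * G : ℕ) := by positivity
    have hrlow : (r i : ℝ) ≤ b * ((v i : ℕ) / (2 * (L + 1) * G : ℕ)) := by
      rw [hri, mul_div_assoc', mul_comm (b : ℝ)]
      exact_mod_cast Nat.cast_div_le (α := ℝ) (m := v i * b) (n := 2 * (L + 1) * G)
    have hrup : (b : ℝ) * ((v i : ℕ) / (2 * (L + 1) * G : ℕ)) ≤ r i + 1 := by
      rw [hri, mul_div_assoc', mul_comm (b : ℝ), div_le_iff₀ hm]
      have := (Nat.lt_div_mul_add (a := v i * b) (b := 2 * (L + 1) * G) (by positivity)).le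
      rw [← Nat.succ_mul] at this
      exact_mod_cast this
    have c1 := mul_le_mul_of_nonneg_right hrlow hη.le
    have c2 := mul_le_mul_of_nonneg_right hrup hη.le
    rw [abs_le] at hmid hblock ⊢
    constructor <;> nlinarith
  · obtain ⟨i, hi⟩ := Function.ne_iff.1 hvv
    refine ⟨i, ?_⟩
    have hne : (1 : ℝ) ≤ |((v i : ℕ) : ℝ) - (v' i : ℕ)| := by
      have h2 : ((v i : ℕ) : ℤ) - (v' i : ℕ) ≠ 0 := fun h => hi (Fin.ext (by omega))
      exact_mod_cast Int.one_le_abs h2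
    rw [← mul_sub, ← sub_div, abs_mul, abs_div, abs_of_pos hη]
    push_cast
    rw [abs_of_pos (show (0 : ℝ) < 2 * (L + 1) * G by positivity)]
    calc (8 * (d : ℝ) + 6) * (η / (2 * (L + 1) * (8 * d + 7)) / G)
        = η * ((8 * d + 6) / (8 * d + 7)) / (2 * (L + 1) * G) := by field_simp
      _ < η * 1 / (2 * (L + 1) * G) := by
          gcongr
          rw [div_lt_one (by positivity)]
          linarith
      _ ≤ η * |((v i : ℕ) : ℝ) - (v' i : ℕ)| / (2 * (L + 1) * G) := by gcongr
      _ = _ := by rw [mul_div_assoc]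

lemma dimH_univ_le_dimH_superPolynomialEmergence_div (hκ : 2 ≤ κ)
    (hA : ∀ i j, A i j = 0 ∨ A i j = 1) {N : ℕ} (hN1 : 1 ≤ N)
    (hN : ∀ n, N ≤ n → ∀ i j, 0 < (A ^ n) i j)
    {σ : Subshift A → Subshift A} (hσ : ∀ x, (σ x).1 = fun n => x.1 (n + 1)) {D : ℕ}
    (hD : 2 ≤ D) :
    dimH (univ : Set (Subshift A)) ≤ dimH {x | superPolynomialEmergence σ x} /
      (((D : NNReal) / (D + 2) : NNReal) : ENNReal) := by
  choose g hg using exists_glue hA (hN (N + 1) (Nat.le_succ N))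
  obtain ⟨z, hfin, hz⟩ := exists_seq_disjoint_finite_orbits hκ hA hN1 hN hσ
  obtain ⟨e, he⟩ := exists_seq_frequently_eq (List ℕ × ℕ)
  let q : ℕ → ℕ := fun k => 4 ^ (k + 2 * N)
  have hqk : ∀ k, k + 2 * N < q k := fun k => Nat.lt_pow_self (by norm_num)
  have hqs : ∀ k, q (k + 1) = 4 * q k := fun k => by simp only [q]; ring
  have hsum : ∀ k, ∑ j ∈ Finset.range (k + 1), (q j + 2 * N) ≤ 3 * q k := by
    intro k
    induction k with
    | zero =>
      have := hqk 0
      simp only [zero_add, Finset.range_one, Finset.sum_singleton]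
      omega
    | succ k ih =>
      rw [Finset.sum_range_succ, hqs]
      have := hqk k
      omega
  obtain ⟨Y, pos, hpos, hYpos, hY⟩ := exists_insertBlocks_limit hg hσ (a := fun k => 3 * D * q k)
    (q := q) (fun k => block g z (fun i => (e k).1.getD i 0 * q k / (e k).2) (e k).1.length)
    (strictMono_nat_of_lt_succ fun k => by
      have := hqk k
      rw [hqs]
      nlinarith)
    (fun k => by
      have := hqk k
      rw [hqs]
      nlinarith) hD (fun k => by have := hsum k; nlinarith)
  refine (dimH_univ_le_of_apply_pos (by omega) hpos hYpos).trans ?_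
  refine ENNReal.div_le_div_right (dimH_mono ?_) _
  rintro _ ⟨x, rfl⟩
  exact superPolynomialEmergence_of_blocks hg hσ hfin hz he
    (fun k => by have := hqk k; omega) (d := 3 * D) (by omega) (hY x)

end Subshift

/-- Let `κ ≥ 2`, let `X ⊆ {1,…,κ}^ℕ` be a topologically mixing subshift of
finite type (determined by a 0-1 transition matrix `A`), with the metric
`d(x,y) = 2^{−min{n : x_n ≠ y_n}}`, and let `σ : X → X` be the left shift. Then the set
`ℰ_σ` of points with super-polynomial pointwise emergence has full Hausdorff dimension:
`dim_H(ℰ_σ) = dim_H(X)`. -/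
theorem highEmergence_full_dimH_subshift
    (κ : ℕ) (hκ : 2 ≤ κ) (A : Matrix (Fin κ) (Fin κ) ℕ)
    (hA : ∀ i j, A i j = 0 ∨ A i j = 1)
    (hmix : ∃ N : ℕ, 1 ≤ N ∧ ∀ n, N ≤ n → ∀ i j, 0 < (A ^ n) i j)
    (σ : {x : ℕ → Fin κ // ∀ n, A (x n) (x (n + 1)) = 1} →
      {x : ℕ → Fin κ // ∀ n, A (x n) (x (n + 1)) = 1})
    (hσ : ∀ x, (σ x).1 = fun n => x.1 (n + 1)) :
    dimH {x | superPolynomialEmergence σ x} =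
      dimH (Set.univ : Set {x : ℕ → Fin κ // ∀ n, A (x n) (x (n + 1)) = 1}) := by
  refine le_antisymm (dimH_mono (subset_univ _)) ?_
  obtain ⟨N, hN1, hN⟩ := hmix
  have hle : ∀ᶠ D : ℕ in atTop,
      dimH (univ : Set (Subshift A)) * (((D : NNReal) / (D + 2) : NNReal) : ENNReal) ≤
        dimH {x | superPolynomialEmergence σ x} := by
    filter_upwards [eventually_ge_atTop 2] with D hD
    refine ENNReal.mul_le_of_le_div ?_
    exact Subshift.dimH_univ_le_dimH_superPolynomialEmergence_div hκ hA hN1 hN hσ hD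
  have hlim : Tendsto (fun D : ℕ => (((D : NNReal) / (D + 2) : NNReal) : ENNReal)) atTop
      (nhds 1) := by
    rw [← ENNReal.coe_one, ENNReal.tendsto_coe]
    exact tendsto_natCast_div_add_atTop (2 : NNReal)
  have := ENNReal.Tendsto.const_mul (a := dimH (univ : Set (Subshift A))) hlim
    (Or.inl one_ne_zero)
  rw [mul_one] at this
  exact le_of_tendsto this hle
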